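/- Let T be a circle-tree and let x be a vertex of T. If deg_T(x) = 2, then the induced subgraph T ∖ {x} is connected and is not a circle-tree. If deg_T(x) = 3, then T ∖ {x} is not connected: it has exactly two connected components, and exactly one of them is a circle-tree. -/

import Mathlib

/-- `C` is a circle in `G`: a finite set of vertices whose induced subgraph is connected
and in which every vertex has exactly two neighbors within `C`. -/
def IsCircleIn {V : Type*} (G : SimpleGraph V) (C : Set V) : Prop :=
  C.Finite ∧ (G.induce C).Connected ∧ ∀ x ∈ C, (G.neighborSet x ∩ C).ncard = 2

/-- The sequence of pairwise disjoint circles `C 0, …, C (k-1)` determines the induced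
subgraph of `G` on `T` as a circle-tree: `T` is the union of the circles, and for each
`0 < j < k`, the graph built from the circles `C 0, …, C (j-1)` is joined to the circle
`C j` by exactly one edge, whose endpoint in the earlier part has degree `2` there. -/
def Determines {V : Type*} (G : SimpleGraph V) (T : Set V) (k : ℕ) (C : ℕ → Set V) : Prop :=
  0 < k ∧
  (∀ i, i < k → IsCircleIn G (C i)) ∧
  (∀ i j, i < k → j < k → i ≠ j → Disjoint (C i) (C j)) ∧
  (⋃ i ∈ Set.Iio k, C i) = T ∧
  ∀ j, 0 < j → j < k →
    (∃! p : V × V, p.1 ∈ (⋃ i ∈ Set.Iio j, C i) ∧ p.2 ∈ C j ∧ G.Adj p.1 p.2) ∧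
    (∀ x y : V, x ∈ (⋃ i ∈ Set.Iio j, C i) → y ∈ C j → G.Adj x y →
      (G.neighborSet x ∩ (⋃ i ∈ Set.Iio j, C i)).ncard = 2)

/-- The induced subgraph of `G` on `T` is a circle-tree. -/
def IsCircleTree {V : Type*} (G : SimpleGraph V) (T : Set V) : Prop :=
  ∃ k C, Determines G T k C

/-- `A` is nonempty and every partition of `A` into two nonempty parts is crossed by an edge. -/
def CutConnected {V : Type*} (G : SimpleGraph V) (A : Set V) : Prop :=
  A.Nonempty ∧ ∀ S ⊆ A, S.Nonempty → (A \ S).Nonempty → ∃ u ∈ S, ∃ v ∈ A \ S, G.Adj u v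

theorem connected_induce_iff_cutConnected {V : Type*} {G : SimpleGraph V} {A : Set V} :
    (G.induce A).Connected ↔ CutConnected G A := by
  constructor
  · intro h
    obtain ⟨a⟩ := h.nonempty
    refine ⟨⟨a, a.2⟩, ?_⟩
    rintro S hS ⟨s, hs⟩ ⟨t, htA, htS⟩
    obtain ⟨w⟩ := h.preconnected ⟨s, hS hs⟩ ⟨t, htA⟩
    obtain ⟨d, -, hd1, hd2⟩ := w.exists_boundary_dart {v | (v : V) ∈ S} hs htS
    exact ⟨d.fst, hd1, d.snd, ⟨d.snd.2, hd2⟩, d.adj⟩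
  · rintro ⟨⟨a, ha⟩, h⟩
    have key : ∀ b : A, (G.induce A).Reachable ⟨a, ha⟩ b := by
      by_contra! hc
      obtain ⟨b, hb⟩ := hc
      obtain ⟨u, ⟨huA, hu⟩, v, ⟨hvA, hv⟩, huv⟩ :=
        h {v | ∃ hv : v ∈ A, (G.induce A).Reachable ⟨a, ha⟩ ⟨v, hv⟩}
          (fun v hv => hv.1) ⟨a, ha, SimpleGraph.Reachable.refl _⟩
          ⟨b, b.2, fun hb' => hb hb'.2⟩
      have : (G.induce A).Adj ⟨u, huA⟩ ⟨v, hvA⟩ := huv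
      exact hv ⟨hvA, hu.trans this.reachable⟩
    exact { preconnected := fun u v => (key u).symm.trans (key v), nonempty := ⟨⟨a, ha⟩⟩ }

theorem CutConnected.union {V : Type*} {G : SimpleGraph V} {A B : Set V}
    (hA : CutConnected G A) (hB : CutConnected G B) {a b : V} (ha : a ∈ A) (hb : b ∈ B)
    (hab : G.Adj a b) : CutConnected G (A ∪ B) := by
  refine ⟨hA.1.mono Set.subset_union_left, fun S hS hS1 hS2 => ?_⟩
  by_contra! hno
  have side : ∀ {X : Set V}, CutConnected G X → X ⊆ A ∪ B → X ⊆ S ∨ Disjoint X S := by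
    intro X hX hXAB
    by_contra! hc
    obtain ⟨hc1, hc2⟩ := hc
    obtain ⟨v, hvX, hvS⟩ := Set.not_subset.1 hc1
    obtain ⟨w, hwX, hwS⟩ := Set.not_disjoint_iff.1 hc2
    obtain ⟨u, hu, z, hz, huz⟩ :=
      hX.2 (X ∩ S) Set.inter_subset_left ⟨w, hwX, hwS⟩ ⟨v, hvX, fun h => hvS h.2⟩
    exact hno u hu.2 z ⟨hXAB hz.1, fun h => hz.2 ⟨hz.1, h⟩⟩ huz
  rcases side hA Set.subset_union_left with h1 | h1 <;>
    rcases side hB Set.subset_union_right with h2 | h2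
  · obtain ⟨v, hv, hvS⟩ := hS2
    exact hvS (Set.union_subset h1 h2 hv)
  · exact hno a (h1 ha) b ⟨Or.inr hb, Set.disjoint_left.1 h2 hb⟩ hab
  · exact hno b (h2 hb) a ⟨Or.inl ha, Set.disjoint_left.1 h1 ha⟩ hab.symm
  · obtain ⟨v, hv⟩ := hS1
    rcases hS hv with h | h
    · exact Set.disjoint_left.1 h1 h hv
    · exact Set.disjoint_left.1 h2 h hv

theorem degree_induce_eq_ncard {V : Type*} (G : SimpleGraph V) (S : Set V) (v : S)
    [Fintype ((G.induce S).neighborSet v)] :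
    (G.induce S).degree v = (G.neighborSet v ∩ S).ncard := by
  rw [← SimpleGraph.card_neighborSet_eq_degree, ← Nat.card_eq_fintype_card,
    Nat.card_coe_set_eq, ← Set.ncard_image_of_injective _ Subtype.val_injective]
  congr 1
  ext w
  simp [and_comm]

theorem neighborSet_inter_union_of_not_adj {V : Type*} {G : SimpleGraph V} {A B : Set V} {a : V}
    (h : ∀ b ∈ B, ¬ G.Adj a b) : G.neighborSet a ∩ (A ∪ B) = G.neighborSet a ∩ A := by
  ext v
  simp only [Set.mem_inter_iff, SimpleGraph.mem_neighborSet, Set.mem_union]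
  have := h v
  tauto

theorem ncard_neighborSet_inter_union {V : Type*} {G : SimpleGraph V} {A B : Set V} {a b : V}
    (hA : A.Finite) (hAB : Disjoint A B) (hb : b ∈ B) (hab : G.Adj a b)
    (h : ∀ v ∈ B, G.Adj a v → v = b) :
    (G.neighborSet a ∩ (A ∪ B)).ncard = (G.neighborSet a ∩ A).ncard + 1 := by
  have : G.neighborSet a ∩ (A ∪ B) = insert b (G.neighborSet a ∩ A) := by
    ext v
    simp only [Set.mem_inter_iff, SimpleGraph.mem_neighborSet, Set.mem_union, Set.mem_insert_iff]
    constructor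
    · rintro ⟨h1, h2 | h2⟩
      · exact Or.inr ⟨h1, h2⟩
      · exact Or.inl (h v h2 h1)
    · rintro (rfl | h1)
      · exact ⟨hab, Or.inr hb⟩
      · exact ⟨h1.1, Or.inl h1.2⟩
  rw [this, Set.ncard_insert_of_notMem (fun h => Set.disjoint_left.1 hAB h.2 hb)
    (hA.subset Set.inter_subset_right)]

/-- In a circle no cut consists of a single edge. -/
theorem IsCircleIn.not_single_edge_cut {V : Type*} {G : SimpleGraph V} {D S : Set V}
    (hD : IsCircleIn G D) (hS : S ⊆ D) {p q : V} (hp : p ∈ S) (hq : q ∈ D \ S) (hpq : G.Adj p q)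
    (huniq : ∀ u ∈ S, ∀ v ∈ D \ S, G.Adj u v → u = p ∧ v = q) : False := by
  classical
  have hSf : S.Finite := hD.1.subset hS
  have : Fintype S := hSf.fintype
  have hunion : S ∪ D \ S = D := Set.union_sdiff_cancel hS
  have hdp := ncard_neighborSet_inter_union hSf Set.disjoint_sdiff_right hq hpq
    (fun v hv hv' => (huniq p hp v hv hv').2)
  rw [hunion, hD.2.2 p (hS hp)] at hdp
  obtain ⟨w, hwp, hw⟩ := (G.induce S).exists_ne_odd_degree_of_exists_odd_degree ⟨p, hp⟩ (by
    rw [degree_induce_eq_ncard, show (G.neighborSet p ∩ S).ncard = 1 by omega]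
    exact odd_one)
  rw [degree_induce_eq_ncard, ← neighborSet_inter_union_of_not_adj (B := D \ S)
    (fun b hb hwb => hwp (Subtype.ext (huniq w w.2 b hb hwb).1)), hunion,
    hD.2.2 w (hS w.2)] at hw
  exact absurd hw (by decide)

theorem IsCircleIn.cutConnected {V : Type*} {G : SimpleGraph V} {D : Set V}
    (hD : IsCircleIn G D) : CutConnected G D :=
  connected_induce_iff_cutConnected.1 hD.2.1

theorem IsCircleIn.eq_of_subset {V : Type*} {G : SimpleGraph V} {C D : Set V}
    (hD : IsCircleIn G D) (hC : IsCircleIn G C) (h : D ⊆ C) : D = C := by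
  refine h.antisymm fun c hc => ?_
  by_contra hcD
  obtain ⟨u, hu, v, hv, huv⟩ := hC.cutConnected.2 D h hD.cutConnected.1 ⟨c, hc, hcD⟩
  have : G.neighborSet u ∩ D = G.neighborSet u ∩ C :=
    Set.eq_of_subset_of_ncard_le (Set.inter_subset_inter_right _ h)
      (by rw [hD.2.2 u hu, hC.2.2 u (h hu)]) (hC.1.subset Set.inter_subset_right)
  have hv' : v ∈ G.neighborSet u ∩ D := this ▸ ⟨huv, hv.1⟩
  exact hv.2 hv'.2

theorem IsCircleIn.exists_adj {V : Type*} {G : SimpleGraph V} {C : Set V} {x : V}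
    (hC : IsCircleIn G C) (hx : x ∈ C) : ∃ y ∈ C, G.Adj x y := by
  have h := hC.2.2 x hx
  obtain ⟨y, hy⟩ := Set.nonempty_of_ncard_ne_zero (s := G.neighborSet x ∩ C) (by omega)
  exact ⟨y, hy.2, hy.1⟩

theorem IsCircleIn.cutConnected_sdiff_singleton {V : Type*} {G : SimpleGraph V} {C : Set V} {x : V}
    (hC : IsCircleIn G C) (hx : x ∈ C) : CutConnected G (C \ {x}) := by
  obtain ⟨y, hy, hxy⟩ := hC.exists_adj hx
  refine ⟨⟨y, hy, hxy.ne'⟩, fun S hS hS1 hS2 => ?_⟩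
  by_contra! hno
  have hSC : S ⊆ C := fun v hv => (hS hv).1
  have hxS : x ∉ S := fun h => (hS h).2 rfl
  obtain ⟨s, hs, v, hv, hsv⟩ := hC.cutConnected.2 S hSC hS1 ⟨x, hx, hxS⟩
  obtain rfl : v = x := by
    by_contra hvx
    exact hno s hs v ⟨⟨hv.1, hvx⟩, hv.2⟩ hsv
  obtain ⟨t, ht, w, hw, htw⟩ := hC.cutConnected.2 ((C \ {v}) \ S) (fun z hz => hz.1.1) hS2
    ⟨v, hx, fun h => h.1.2 rfl⟩
  obtain rfl : w = v := by
    by_contra hwv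
    have hwS : w ∈ S := by
      by_contra h
      exact hw.2 ⟨⟨hw.1, hwv⟩, h⟩
    exact hno w hwS t ht htw.symm
  have hst : s ≠ t := fun h => ht.2 (h ▸ hs)
  have hN : {s, t} = G.neighborSet w ∩ C := by
    refine Set.eq_of_subset_of_ncard_le ?_ ?_ (hC.1.subset Set.inter_subset_right)
    · rintro z (rfl | rfl)
      · exact ⟨hsv.symm, hSC hs⟩
      · exact ⟨htw.symm, ht.1.1⟩
    · rw [hC.2.2 w hx, Set.ncard_pair hst]
  refine hC.not_single_edge_cut hSC hs hv hsv fun u hu z hz huz => ?_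
  obtain rfl : z = w := by
    by_contra hzw
    exact hno u hu z ⟨⟨hz.1, hzw⟩, hz.2⟩ huz
  have hu' : u ∈ ({s, t} : Set V) := hN ▸ ⟨huz.symm, hSC hu⟩
  rcases hu' with rfl | rfl
  · exact ⟨rfl, rfl⟩
  · exact absurd hu ht.2

/-- Circle-trees built by successively attaching circles, without recording the sequence. -/
inductive CircleTree {V : Type*} (G : SimpleGraph V) : Set V → Prop
  | circle {C : Set V} (hC : IsCircleIn G C) : CircleTree G C
  | attach {T C : Set V} {p q : V} (hT : CircleTree G T) (hC : IsCircleIn G C)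
      (hTC : Disjoint T C) (hp : p ∈ T) (hq : q ∈ C) (hpq : G.Adj p q)
      (huniq : ∀ u ∈ T, ∀ v ∈ C, G.Adj u v → u = p ∧ v = q)
      (hdeg : (G.neighborSet p ∩ T).ncard = 2) : CircleTree G (T ∪ C)

theorem biUnion_Iio_succ {V : Type*} (C : ℕ → Set V) (k : ℕ) :
    (⋃ i ∈ Set.Iio (k + 1), C i) = (⋃ i ∈ Set.Iio k, C i) ∪ C k := by
  ext v
  simp only [Set.mem_iUnion, Set.mem_Iio, Set.mem_union, exists_prop]
  constructor
  · rintro ⟨i, hi, hv⟩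
    rcases Nat.lt_succ_iff_lt_or_eq.1 hi with h | rfl
    · exact Or.inl ⟨i, h, hv⟩
    · exact Or.inr hv
  · rintro (⟨i, hi, hv⟩ | hv)
    · exact ⟨i, by omega, hv⟩
    · exact ⟨k, by omega, hv⟩

theorem Determines.circleTree {V : Type*} {G : SimpleGraph V} {T : Set V} {k : ℕ} {C : ℕ → Set V}
    (h : Determines G T k C) : CircleTree G T := by
  obtain ⟨hk, hC, hdisj, rfl, hstep⟩ := h
  induction k with
  | zero => omega
  | succ k ih =>
    rcases Nat.eq_zero_or_pos k with rfl | hk0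
    · have : (⋃ i ∈ Set.Iio (0 + 1), C i) = C 0 := by rw [biUnion_Iio_succ]; simp
      rw [this]
      exact .circle (hC 0 (by omega))
    · have hT := ih hk0 (fun i hi => hC i (by omega))
        (fun i j hi hj => hdisj i j (by omega) (by omega)) (fun j hj hjk => hstep j hj (by omega))
      obtain ⟨⟨⟨p, q⟩, ⟨hp, hq, hpq⟩, huniq⟩, hdeg⟩ := hstep k hk0 (by omega)
      rw [biUnion_Iio_succ]
      refine .attach hT (hC k (by omega)) ?_ hp hq hpq (fun u hu v hv huv => ?_)
        (hdeg p q hp hq hpq)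
      · simp only [Set.disjoint_iUnion_left]
        intro i hi
        have hi : i < k := hi
        exact hdisj i k (by omega) (by omega) (by omega)
      · simpa using huniq (u, v) ⟨hu, hv, huv⟩

theorem CircleTree.isCircleTree {V : Type*} {G : SimpleGraph V} {T : Set V}
    (h : CircleTree G T) : IsCircleTree G T := by
  induction h with
  | @circle C hC =>
    refine ⟨1, fun _ => C, one_pos, fun _ _ => hC, fun i j hi hj hij => by omega, ?_,
      fun j hj hj' => by omega⟩
    rw [biUnion_Iio_succ]
    simp
  | @attach T C p q _ hC hTC hp hq hpq huniq hdeg ih =>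
    obtain ⟨k, D, hk, hD, hdisj, hT, hstep⟩ := ih
    have hlt : ∀ i, i < k → (if i < k then D i else C) = D i := fun i hi => if_pos hi
    have hU : ∀ j, j ≤ k →
        (⋃ i ∈ Set.Iio j, (if i < k then D i else C)) = ⋃ i ∈ Set.Iio j, D i := fun j hj =>
      Set.iUnion₂_congr fun i hi => hlt i (lt_of_lt_of_le hi hj)
    have hDC : ∀ i, i < k → Disjoint (D i) C := fun i hi =>
      hTC.mono_left (hT ▸ Set.subset_biUnion_of_mem (u := D) (show i ∈ Set.Iio k from hi))
    refine ⟨k + 1, fun i => if i < k then D i else C, by omega, fun i _ => ?_,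
      fun i j hi hj hij => ?_, ?_, fun j hj0 hjk => ?_⟩
    · dsimp only
      split_ifs with h
      · exact hD i h
      · exact hC
    · dsimp only
      split_ifs with h1 h2 h2
      · exact hdisj i j h1 h2 hij
      · exact hDC i h1
      · exact (hDC j h2).symm
      · omega
    · rw [biUnion_Iio_succ, hU k le_rfl, hT, if_neg (lt_irrefl k)]
    · dsimp only
      rw [hU j (by omega)]
      rcases Nat.lt_succ_iff_lt_or_eq.1 hjk with h | rfl
      · rw [hlt j h]
        exact hstep j hj0 h
      · rw [hT, if_neg (lt_irrefl _)]
        refine ⟨⟨(p, q), ⟨hp, hq, hpq⟩, ?_⟩, ?_⟩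
        · rintro ⟨u, v⟩ ⟨hu, hv, huv⟩
          exact Prod.ext_iff.2 (huniq u hu v hv huv)
        · intro u v hu hv huv
          rw [(huniq u hu v hv huv).1]
          exact hdeg

theorem isCircleTree_iff_circleTree {V : Type*} {G : SimpleGraph V} {T : Set V} :
    IsCircleTree G T ↔ CircleTree G T :=
  ⟨fun ⟨_, _, h⟩ => h.circleTree, CircleTree.isCircleTree⟩

theorem CircleTree.finite {V : Type*} {G : SimpleGraph V} {T : Set V} (h : CircleTree G T) :
    T.Finite := by
  induction h with
  | circle hC => exact hC.1
  | attach _ hC _ _ _ _ _ _ ih => exact ih.union hC.1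

theorem CircleTree.cutConnected {V : Type*} {G : SimpleGraph V} {T : Set V}
    (h : CircleTree G T) : CutConnected G T := by
  induction h with
  | circle hC => exact hC.cutConnected
  | attach _ hC _ hp hq hpq _ _ ih => exact ih.union hC.cutConnected hp hq hpq

theorem CircleTree.exists_circle {V : Type*} {G : SimpleGraph V} {T : Set V} {x : V}
    (h : CircleTree G T) (hx : x ∈ T) : ∃ D ⊆ T, IsCircleIn G D ∧ x ∈ D := by
  induction h with
  | circle hC => exact ⟨_, subset_rfl, hC, hx⟩
  | attach _ hC _ _ _ _ _ _ ih =>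
    rcases hx with hx | hx
    · obtain ⟨D, hD, hD'⟩ := ih hx
      exact ⟨D, hD.trans Set.subset_union_left, hD'⟩
    · exact ⟨_, Set.subset_union_right, hC, hx⟩

theorem CircleTree.two_le_ncard {V : Type*} {G : SimpleGraph V} {T : Set V} {x : V}
    (h : CircleTree G T) (hx : x ∈ T) : 2 ≤ (G.neighborSet x ∩ T).ncard := by
  obtain ⟨D, hDT, hD, hxD⟩ := h.exists_circle hx
  rw [← hD.2.2 x hxD]
  exact Set.ncard_le_ncard (Set.inter_subset_inter_right _ hDT)
    (h.finite.subset Set.inter_subset_right)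

/-- A circle cannot use the single edge joining two vertex sets. -/
theorem IsCircleIn.subset_or_subset {V : Type*} {G : SimpleGraph V} {D T C : Set V} {p q : V}
    (hD : IsCircleIn G D)
    (huniq : ∀ u ∈ T, ∀ v ∈ C, G.Adj u v → u = p ∧ v = q) (h : D ⊆ T ∪ C) :
    D ⊆ T ∨ D ⊆ C := by
  by_contra! hc
  obtain ⟨c, hcD, hcT⟩ := Set.not_subset.1 hc.1
  obtain ⟨t, htD, htC⟩ := Set.not_subset.1 hc.2
  have hdiff : ∀ v ∈ D \ (D ∩ T), v ∈ C := fun v hv =>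
    (h hv.1).resolve_left fun hvT => hv.2 ⟨hv.1, hvT⟩
  obtain ⟨u, hu, v, hv, huv⟩ := hD.cutConnected.2 (D ∩ T) Set.inter_subset_left
    ⟨t, htD, (h htD).resolve_right htC⟩ ⟨c, hcD, fun h => hcT h.2⟩
  obtain ⟨rfl, rfl⟩ := huniq u hu.2 v (hdiff v hv) huv
  exact hD.not_single_edge_cut Set.inter_subset_left hu hv huv
    fun a ha b hb hab => huniq a ha.2 b (hdiff b hb) hab

theorem CircleTree.circle_unique {V : Type*} {G : SimpleGraph V} {T D E : Set V} {x : V}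
    (h : CircleTree G T) (hD : IsCircleIn G D) (hE : IsCircleIn G E) (hDT : D ⊆ T) (hET : E ⊆ T)
    (hxD : x ∈ D) (hxE : x ∈ E) : D = E := by
  induction h with
  | circle hC => rw [hD.eq_of_subset hC hDT, hE.eq_of_subset hC hET]
  | attach _ hC hTC _ _ _ huniq _ ih =>
    rcases hD.subset_or_subset huniq hDT with h1 | h1 <;>
      rcases hE.subset_or_subset huniq hET with h2 | h2
    · exact ih h1 h2
    · exact absurd (h2 hxE) (Set.disjoint_left.1 hTC (h1 hxD))
    · exact absurd (h1 hxD) (Set.disjoint_left.1 hTC (h2 hxE))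
    · rw [hD.eq_of_subset hC h1, hE.eq_of_subset hC h2]

/-- A circle-tree contained in `T` that meets a circle of `T` contains this circle. -/
theorem CircleTree.circle_subset {V : Type*} {G : SimpleGraph V} {T A D : Set V}
    (h : CircleTree G T) (hA : CircleTree G A) (hAT : A ⊆ T) (hD : IsCircleIn G D) (hDT : D ⊆ T)
    (hDA : (D ∩ A).Nonempty) : D ⊆ A := by
  obtain ⟨a, haD, haA⟩ := hDA
  obtain ⟨E, hEA, hE, haE⟩ := hA.exists_circle haA
  rw [h.circle_unique hD hE hDT (hEA.trans hAT) haD haE]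
  exact hEA

theorem union_sdiff_singleton_left {V : Type*} {T C : Set V} {x : V} (h : x ∉ C) :
    (T ∪ C) \ {x} = T \ {x} ∪ C := by
  rw [Set.union_sdiff_distrib, Set.sdiff_singleton_eq_self h]

theorem union_sdiff_singleton_right {V : Type*} {T C : Set V} {x : V} (h : x ∉ T) :
    (T ∪ C) \ {x} = T ∪ C \ {x} := by
  rw [Set.union_sdiff_distrib, Set.sdiff_singleton_eq_self h]

theorem CircleTree.cutConnected_sdiff_singleton {V : Type*} {G : SimpleGraph V} {T : Set V} {x : V}
    (h : CircleTree G T) (hx : x ∈ T) (hdx : (G.neighborSet x ∩ T).ncard = 2) :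
    CutConnected G (T \ {x}) := by
  induction h with
  | circle hC => exact hC.cutConnected_sdiff_singleton hx
  | @attach T C p q hT hC hTC hp hq hpq huniq hdeg ih =>
    rcases hx with hx | hx
    · have hxp : p ≠ x := by
        rintro rfl
        rw [ncard_neighborSet_inter_union hT.finite hTC hq hpq
          (fun v hv hv' => (huniq p hp v hv hv').2)] at hdx
        omega
      rw [neighborSet_inter_union_of_not_adj
        (fun b hb hxb => hxp (huniq x hx b hb hxb).1.symm)] at hdx
      rw [union_sdiff_singleton_left (Set.disjoint_left.1 hTC hx)]
      exact (ih hx hdx).union hC.cutConnected ⟨hp, hxp⟩ hq hpq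
    · have hxq : q ≠ x := by
        rintro rfl
        rw [Set.union_comm, ncard_neighborSet_inter_union hC.1 hTC.symm hp hpq.symm
          (fun v hv hv' => (huniq v hv q hq hv'.symm).1), hC.2.2 q hq] at hdx
        omega
      rw [union_sdiff_singleton_right (Set.disjoint_right.1 hTC hx)]
      exact hT.cutConnected.union (hC.cutConnected_sdiff_singleton hx) hp ⟨hq, hxq⟩ hpq

theorem CircleTree.exists_components {V : Type*} {G : SimpleGraph V} {T : Set V} {x : V}
    (h : CircleTree G T) (hx : x ∈ T) (hdx : (G.neighborSet x ∩ T).ncard = 3) :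
    ∃ A B D : Set V, A ∪ B = T \ {x} ∧ Disjoint A B ∧ CircleTree G A ∧ CutConnected G B ∧
      (∀ a ∈ A, ∀ b ∈ B, ¬ G.Adj a b) ∧
      IsCircleIn G D ∧ D ⊆ T ∧ x ∈ D ∧ (D ∩ B).Nonempty := by
  induction h with
  | circle hC =>
    rw [hC.2.2 x hx] at hdx
    omega
  | @attach T C p q hT hC hTC hp hq hpq huniq hdeg ih =>
    rcases hx with hx | hx
    · have hxC := Set.disjoint_left.1 hTC hx
      rw [union_sdiff_singleton_left hxC]
      by_cases hxp : x = p
      · subst hxp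
        obtain ⟨D, hDT, hD, hxD⟩ := hT.exists_circle hx
        obtain ⟨y, hy, hxy⟩ := hD.exists_adj hxD
        refine ⟨C, T \ {x}, D, Set.union_comm _ _, hTC.symm.mono_right Set.sdiff_subset,
          .circle hC, hT.cutConnected_sdiff_singleton hx hdeg, ?_, hD,
          hDT.trans Set.subset_union_left, hxD, ⟨y, hy, hDT hy, hxy.ne'⟩⟩
        exact fun a ha b hb hab => hb.2 (huniq b hb.1 a ha hab.symm).1
      · rw [neighborSet_inter_union_of_not_adj
          (fun b hb hxb => hxp (huniq x hx b hb hxb).1)] at hdx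
        obtain ⟨A, B, D, hAB, hABd, hA, hB, hno, hD, hDT, hxD, hDB⟩ := ih hx hdx
        have hAT : A ⊆ T := fun a ha => (hAB.subset (Or.inl ha)).1
        have hBT : B ⊆ T := fun b hb => (hAB.subset (Or.inr hb)).1
        have hpAB : p ∈ A ∪ B := hAB ▸ ⟨hp, fun h => hxp h.symm⟩
        have hDTC : D ⊆ T ∪ C := hDT.trans Set.subset_union_left
        rcases hpAB with hpA | hpB
        · refine ⟨A ∪ C, B, D, ?_, ?_, .attach hA hC (hTC.mono_left hAT) hpA hq hpq
            (fun u hu => huniq u (hAT hu)) ?_, hB, ?_, hD, hDTC, hxD, hDB⟩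
          · rw [← hAB, Set.union_right_comm]
          · exact hABd.union_left (hTC.symm.mono_right hBT)
          · refine le_antisymm ?_ (hA.two_le_ncard hpA)
            rw [← hdeg]
            exact Set.ncard_le_ncard (Set.inter_subset_inter_right _ hAT)
              (hT.finite.subset Set.inter_subset_right)
          · rintro a (ha | ha) b hb hab
            · exact hno a ha b hb hab
            · obtain rfl := (huniq b (hBT hb) a ha hab.symm).1
              exact Set.disjoint_left.1 hABd hpA hb
        · refine ⟨A, B ∪ C, D, ?_, ?_, hA, hB.union hC.cutConnected hpB hq hpq, ?_, hD, hDTC, hxD,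
            hDB.mono (Set.inter_subset_inter_right _ Set.subset_union_left)⟩
          · rw [← hAB, Set.union_assoc]
          · exact hABd.union_right (hTC.mono_left hAT)
          · rintro a ha b (hb | hb) hab
            · exact hno a ha b hb hab
            · obtain rfl := (huniq a (hAT ha) b hb hab).1
              exact Set.disjoint_left.1 hABd ha hpB
    · have hxT := Set.disjoint_right.1 hTC hx
      rw [union_sdiff_singleton_right hxT]
      have hxq : x = q := by
        by_contra hxq
        rw [Set.union_comm, neighborSet_inter_union_of_not_adj
          (fun b hb hxb => hxq (huniq b hb x hx hxb.symm).2), hC.2.2 x hx] at hdx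
        omega
      subst hxq
      obtain ⟨y, hy, hxy⟩ := hC.exists_adj hx
      refine ⟨T, C \ {x}, C, rfl, hTC.mono_right Set.sdiff_subset, hT,
        hC.cutConnected_sdiff_singleton hx, ?_, hC, Set.subset_union_right, hx,
        ⟨y, hy, hy, hxy.ne'⟩⟩
      exact fun a ha b hb hab => hb.2 (huniq a ha b hb.1 hab).2

theorem stmt11 {V : Type} (G : SimpleGraph V) (T : Set V) (x : V)
    (hT : IsCircleTree G T) (hx : x ∈ T) :
    ((G.neighborSet x ∩ T).ncard = 2 →
      (G.induce (T \ {x})).Connected ∧ ¬ IsCircleTree G (T \ {x})) ∧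
    ((G.neighborSet x ∩ T).ncard = 3 →
      ¬ (G.induce (T \ {x})).Connected ∧
      ∃ A B : Set V, A ∪ B = T \ {x} ∧ Disjoint A B ∧ A.Nonempty ∧ B.Nonempty ∧
        (G.induce A).Connected ∧ (G.induce B).Connected ∧
        (∀ a ∈ A, ∀ b ∈ B, ¬ G.Adj a b) ∧
        ((IsCircleTree G A ∧ ¬ IsCircleTree G B) ∨
          (IsCircleTree G B ∧ ¬ IsCircleTree G A))) := by
  simp only [isCircleTree_iff_circleTree, connected_induce_iff_cutConnected] at hT ⊢
  refine ⟨fun hdx => ⟨hT.cutConnected_sdiff_singleton hx hdx, fun hT' => ?_⟩, fun hdx => ?_⟩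
  · obtain ⟨D, hDT, hD, hxD⟩ := hT.exists_circle hx
    obtain ⟨y, hy, hxy⟩ := hD.exists_adj hxD
    exact (hT.circle_subset hT' Set.sdiff_subset hD hDT ⟨y, hy, hDT hy, hxy.ne'⟩ hxD).2 rfl
  · obtain ⟨A, B, D, hAB, hABd, hA, hB, hno, hD, hDT, hxD, hDB⟩ := hT.exists_components hx hdx
    have hBT : B ⊆ T \ {x} := hAB ▸ Set.subset_union_right
    refine ⟨fun hc => ?_, A, B, hAB, hABd, hA.cutConnected.1, hB.1, hA.cutConnected, hB, hno,
      Or.inl ⟨hA, fun hB' => ?_⟩⟩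
    · obtain ⟨b, hb⟩ := hB.1
      obtain ⟨u, hu, v, hv, huv⟩ := hc.2 A (hAB ▸ Set.subset_union_left) hA.cutConnected.1
        ⟨b, hBT hb, Set.disjoint_right.1 hABd hb⟩
      rw [← hAB] at hv
      exact hno u hu v (hv.1.resolve_left hv.2) huv
    · exact (hBT (hT.circle_subset hB' (hBT.trans Set.sdiff_subset) hD hDT hDB hxD)).2 rfl
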